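/- (Corollary: boundedness of the last row) There exist polynomial maps P_1, …, P_n, in the (n−1)·n entries of the first n−1 rows of an n×n matrix together with n further variables, such that for every X = [[A,u],[v,w]] ∈ 𝒲 and every 1 ≤ j ≤ n, the (n,j)-entry of A equals P_j evaluated at the entries of the first n−1 rows of A and at the coefficients a_1, …, a_n of the characteristic polynomial of A (where a_i := −(the coefficient of T^{n−i} in the characteristic polynomial of A)). -/

import Mathlib

open Matrix MeasureTheory

namespace ZhangRTF

variable {F : Type*} [Field F] {n : ℕ}

/-- Block diagonal embedding `diag(h,1) ∈ M_{n+1}(F)` of `h ∈ M_n(F)`. -/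
def emb (h : Matrix (Fin n) (Fin n) F) : Matrix (Fin (n + 1)) (Fin (n + 1)) F :=
  Matrix.of fun i j =>
    if hi : (i : ℕ) < n then
      (if hj : (j : ℕ) < n then h ⟨i, hi⟩ ⟨j, hj⟩ else 0)
    else (if (j : ℕ) < n then 0 else 1)

/-- Conjugation action of `GL_n(F)` on `M_{n+1}(F)`: `h·X = diag(h,1) X diag(h,1)⁻¹`. -/
def act (h : Matrix.GeneralLinearGroup (Fin n) F)
    (X : Matrix (Fin (n + 1)) (Fin (n + 1)) F) : Matrix (Fin (n + 1)) (Fin (n + 1)) F :=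
  emb (h : Matrix (Fin n) (Fin n) F) * X *
    emb ((h⁻¹ : Matrix.GeneralLinearGroup (Fin n) F) : Matrix (Fin n) (Fin n) F)

/-- The upper-left `n × n` block `A` of `X = [[A,u],[v,w]]`. -/
def blockA (X : Matrix (Fin (n + 1)) (Fin (n + 1)) F) : Matrix (Fin n) (Fin n) F :=
  Matrix.of fun i j => X i.castSucc j.castSucc

/-- The upper-right column `u` of `X = [[A,u],[v,w]]`. -/
def blockU (X : Matrix (Fin (n + 1)) (Fin (n + 1)) F) : Fin n → F :=
  fun i => X i.castSucc (Fin.last n)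

/-- The lower-left row `v` of `X = [[A,u],[v,w]]`. -/
def blockV (X : Matrix (Fin (n + 1)) (Fin (n + 1)) F) : Fin n → F :=
  fun j => X (Fin.last n) j.castSucc

/-- The lower-right corner `w` of `X = [[A,u],[v,w]]`. -/
def blockW (X : Matrix (Fin (n + 1)) (Fin (n + 1)) F) : F :=
  X (Fin.last n) (Fin.last n)

/-- `δ₊(X)`: the matrix whose `j`-th column is `A^{n-j} u` (`1 ≤ j ≤ n`, 1-indexed). -/
def deltaPlus (X : Matrix (Fin (n + 1)) (Fin (n + 1)) F) : Matrix (Fin n) (Fin n) F :=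
  Matrix.of fun i j => (blockA X ^ (n - 1 - (j : ℕ)) *ᵥ blockU X) i

/-- `δ₋(X)`: the matrix whose `i`-th row is `v A^{i-1}` (`1 ≤ i ≤ n`, 1-indexed). -/
def deltaMinus (X : Matrix (Fin (n + 1)) (Fin (n + 1)) F) : Matrix (Fin n) (Fin n) F :=
  Matrix.of fun i j => (blockV X ᵥ* blockA X ^ (i : ℕ)) j

/-- `Δ₊(X) = det δ₊(X)`. -/
def DeltaPlus (X : Matrix (Fin (n + 1)) (Fin (n + 1)) F) : F := (deltaPlus X).det

/-- `Δ₋(X) = det δ₋(X)`. -/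
def DeltaMinus (X : Matrix (Fin (n + 1)) (Fin (n + 1)) F) : F := (deltaMinus X).det

/-- The `a`-invariants: `a_i = -(coefficient of T^{n-i} in charpoly A)` (1-indexed). -/
noncomputable def aInv (X : Matrix (Fin (n + 1)) (Fin (n + 1)) F) : Fin n → F :=
  fun i => -((blockA X).charpoly.coeff (n - 1 - (i : ℕ)))

/-- The `b`-invariants: `b_0 = w` and `b_j = v A^{j-1} u` for `1 ≤ j ≤ n`. -/
def bInv (X : Matrix (Fin (n + 1)) (Fin (n + 1)) F) : Fin (n + 1) → F :=
  fun j => if (j : ℕ) = 0 then blockW X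
    else blockV X ⬝ᵥ (blockA X ^ ((j : ℕ) - 1) *ᵥ blockU X)

/-- The invariants map `π : M_{n+1}(F) → F^n × F^{n+1}`. -/
noncomputable def invMap (X : Matrix (Fin (n + 1)) (Fin (n + 1)) F) : (Fin n → F) × (Fin (n + 1) → F) :=
  (aInv X, bInv X)

/-- The regular nilpotent `ξ₊`: `(i,i+1)`-entries equal to `1`, all others `0`. -/
def xiPlus (n : ℕ) : Matrix (Fin (n + 1)) (Fin (n + 1)) F :=
  Matrix.of fun i j => if (j : ℕ) = (i : ℕ) + 1 then 1 else 0

/-- The section `σ(a,b)` of the invariants map. -/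
def sectSigma (a : Fin n → F) (b : Fin (n + 1) → F) : Matrix (Fin (n + 1)) (Fin (n + 1)) F :=
  Matrix.of fun i j =>
    if hi : (i : ℕ) < n then
      (if (j : ℕ) = 0 then a ⟨i, hi⟩ else 0) + (if (j : ℕ) = (i : ℕ) + 1 then 1 else 0)
    else b j.rev

/-- The variant section `σ'(a,b)`. -/
def sectSigma' (a : Fin n → F) (b : Fin (n + 1) → F) : Matrix (Fin (n + 1)) (Fin (n + 1)) F :=
  Matrix.of fun i j =>
    if (i : ℕ) < n - 1 then (if (j : ℕ) = (i : ℕ) + 1 then 1 else 0)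
    else if (i : ℕ) = n - 1 then
      (if hj : (j : ℕ) < n then a ⟨n - 1 - (j : ℕ), by omega⟩ else 1)
    else b j.rev

/-- Membership in `N_{n,-}`: lower triangular with unit diagonal. -/
def IsLowerUni (h : Matrix (Fin n) (Fin n) F) : Prop :=
  (∀ i, h i i = 1) ∧ ∀ i j : Fin n, i < j → h i j = 0

/-- Membership in `N_n`: upper triangular with unit diagonal. -/
def IsUpperUni (h : Matrix (Fin n) (Fin n) F) : Prop :=
  (∀ i, h i i = 1) ∧ ∀ i j : Fin n, j < i → h i j = 0

/-- Membership in the subvariety `𝒲`: superdiagonal entries `1`,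
entries above the superdiagonal `0`. -/
def memW (X : Matrix (Fin (n + 1)) (Fin (n + 1)) F) : Prop :=
  ∀ i j : Fin (n + 1),
    ((j : ℕ) = (i : ℕ) + 1 → X i j = 1) ∧ ((i : ℕ) + 1 < (j : ℕ) → X i j = 0)

/-- `p : 𝒲 → 𝒱`, replacing the last row by zero. -/
def pMap (X : Matrix (Fin (n + 1)) (Fin (n + 1)) F) : Matrix (Fin (n + 1)) (Fin (n + 1)) F :=
  Matrix.of fun i j => if (i : ℕ) = n then 0 else X i j

/-- `p' : 𝒲 → 𝒱'`, replacing the last row and the first column by zero. -/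
def pMap' (X : Matrix (Fin (n + 1)) (Fin (n + 1)) F) : Matrix (Fin (n + 1)) (Fin (n + 1)) F :=
  Matrix.of fun i j => if (i : ℕ) = n ∨ (j : ℕ) = 0 then 0 else X i j

/-- The determinant of an element of `GL_n(F)`, as a unit of `F`. -/
def GLdet (h : Matrix.GeneralLinearGroup (Fin n) F) : Fˣ :=
  Units.map Matrix.detMonoidHom h

end ZhangRTF

open ZhangRTF

/-- Powers of a lower Hessenberg matrix and of its truncation have the same first row. -/
theorem hess_row {F : Type*} [Field F] {n : ℕ} (hn : 1 ≤ n) (A B : Matrix (Fin n) (Fin n) F)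
    (hB : ∀ i j : Fin n, (i : ℕ) < n - 1 → B i j = A i j)
    (h1 : ∀ i j : Fin n, (j : ℕ) = (i : ℕ) + 1 → A i j = 1)
    (h0 : ∀ i j : Fin n, (i : ℕ) + 1 < (j : ℕ) → A i j = 0) (k : ℕ) (hk : k ≤ n - 1) :
    ∀ l : Fin n, (A ^ k) ⟨0, hn⟩ l = (B ^ k) ⟨0, hn⟩ l ∧
      (k < (l : ℕ) → (B ^ k) ⟨0, hn⟩ l = 0) ∧ ((l : ℕ) = k → (B ^ k) ⟨0, hn⟩ l = 1) := by
  induction k with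
  | zero =>
    intro l
    refine ⟨by simp, fun h => ?_, fun h => ?_⟩
    · rw [pow_zero, Matrix.one_apply_ne]
      intro h'
      rw [← h'] at h
      simp at h
    · have : l = ⟨0, hn⟩ := Fin.ext h
      rw [pow_zero, this, Matrix.one_apply_eq]
  | succ k ih =>
    have ih := ih (by omega)
    intro l
    refine ⟨?_, fun h => ?_, fun h => ?_⟩
    · rw [pow_succ, pow_succ, Matrix.mul_apply, Matrix.mul_apply]
      refine Finset.sum_congr rfl fun i _ => ?_
      rw [(ih i).1]
      by_cases hi : k < (i : ℕ)
      · rw [(ih i).2.1 hi, zero_mul, zero_mul]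
      · rw [hB i l (by omega)]
    · rw [pow_succ, Matrix.mul_apply]
      refine Finset.sum_eq_zero fun i _ => ?_
      by_cases hi : k < (i : ℕ)
      · rw [(ih i).2.1 hi, zero_mul]
      · rw [hB i l (by omega), h0 i l (by omega), mul_zero]
    · rw [pow_succ, Matrix.mul_apply, Finset.sum_eq_single ⟨k, by omega⟩]
      · rw [(ih _).2.2 rfl, hB _ l (by simp; omega), h1 _ l (by simpa using h), one_mul]
      · intro i _ hne
        have hne' : (i : ℕ) ≠ k := fun h => hne (Fin.ext h)
        by_cases hi : k < (i : ℕ)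
        · rw [(ih i).2.1 hi, zero_mul]
        · rw [hB i l (by omega), h0 i l (by omega), mul_zero]
      · simp

theorem last_row_formula {F : Type*} [Field F] {n : ℕ} (hn : 1 ≤ n) (A B : Matrix (Fin n) (Fin n) F)
    (hB : ∀ i j : Fin n, (i : ℕ) < n - 1 → B i j = A i j)
    (hB0 : ∀ i j : Fin n, ¬ (i : ℕ) < n - 1 → B i j = 0)
    (h1 : ∀ i j : Fin n, (j : ℕ) = (i : ℕ) + 1 → A i j = 1)
    (h0 : ∀ i j : Fin n, (i : ℕ) + 1 < (j : ℕ) → A i j = 0) (j : Fin n)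
    (t : Fin n) (ht : (t : ℕ) = n - 1) :
    A t j = -(B ^ n) ⟨0, hn⟩ j +
      ∑ i : Fin n, -(A.charpoly.coeff (n - 1 - (i : ℕ))) * (B ^ (n - 1 - (i : ℕ))) ⟨0, hn⟩ j := by
  have key := hess_row hn A B hB h1 h0
  have hCH := congrFun (congrFun (Matrix.aeval_self_charpoly A) ⟨0, hn⟩) j
  rw [Polynomial.aeval_eq_sum_range, Matrix.charpoly_natDegree_eq_dim, Fintype.card_fin,
    Finset.sum_range_succ] at hCH
  have hlead : A.charpoly.coeff n = 1 := by
    have := (Matrix.charpoly_monic A).coeff_natDegree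
    rwa [Matrix.charpoly_natDegree_eq_dim, Fintype.card_fin] at this
  rw [hlead, one_smul, Matrix.add_apply, Matrix.sum_apply, Matrix.zero_apply] at hCH
  have hs : ∑ i : Fin n, -(A.charpoly.coeff (n - 1 - (i : ℕ))) * (B ^ (n - 1 - (i : ℕ))) ⟨0, hn⟩ j
      = -∑ k ∈ Finset.range n, (A.charpoly.coeff k • A ^ k) ⟨0, hn⟩ j := by
    rw [← Finset.sum_range_reflect, Finset.sum_range, ← Finset.sum_neg_distrib]
    refine Finset.sum_congr rfl fun i _ => ?_
    rw [Matrix.smul_apply, smul_eq_mul, (key _ (by omega) j).1, neg_mul]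
  have hpow : (A ^ n) ⟨0, hn⟩ j = (B ^ n) ⟨0, hn⟩ j + A t j := by
    obtain ⟨m, rfl⟩ : ∃ m, n = m + 1 := ⟨n - 1, by omega⟩
    obtain rfl : t = Fin.last m := Fin.ext (by simpa using ht)
    rw [pow_succ, pow_succ, Matrix.mul_apply, Matrix.mul_apply, Fin.sum_univ_castSucc,
      Fin.sum_univ_castSucc]
    rw [hB0 (Fin.last m) j (by simp), mul_zero, add_zero, (key m (by simp) (Fin.last m)).1,
      (key m (by simp) (Fin.last m)).2.2 (by simp), one_mul]
    congr 1
    refine Finset.sum_congr rfl fun i _ => ?_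
    rw [(key m (by simp) _).1, hB _ _ (by simp)]
  rw [hs]
  linear_combination hCH - hpow

/-- Corollary: for `X = [[A,u],[v,w]] ∈ 𝒲`, each entry of the last row of `A` is a
polynomial in the entries of the first `n-1` rows of `A` and the coefficients of the
characteristic polynomial of `A`. -/
theorem last_row_polynomial (n : ℕ) (hn : 1 ≤ n) (F : Type*) [Field F] :
    ∃ P : Fin n → MvPolynomial ((Fin (n - 1) × Fin n) ⊕ Fin n) F,
      ∀ X : Matrix (Fin (n + 1)) (Fin (n + 1)) F, memW X →
        ∀ j : Fin n,
          blockA X ⟨n - 1, by omega⟩ j =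
            MvPolynomial.eval
              (Sum.elim
                (fun p : Fin (n - 1) × Fin n =>
                  blockA X ⟨(p.1 : ℕ), by have := p.1.isLt; omega⟩ p.2)
                (aInv X)) (P j) := by
  classical
  let Bp : Matrix (Fin n) (Fin n) (MvPolynomial ((Fin (n - 1) × Fin n) ⊕ Fin n) F) :=
    Matrix.of fun i j => if h : (i : ℕ) < n - 1 then MvPolynomial.X (Sum.inl (⟨i, h⟩, j)) else 0
  refine ⟨fun j => -(Bp ^ n) ⟨0, hn⟩ j +
    ∑ i : Fin n, MvPolynomial.X (Sum.inr i) * (Bp ^ (n - 1 - (i : ℕ))) ⟨0, hn⟩ j, ?_⟩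
  intro X hX j
  set e := (Sum.elim
                (fun p : Fin (n - 1) × Fin n =>
                  blockA X ⟨(p.1 : ℕ), by have := p.1.isLt; omega⟩ p.2)
                (aInv X)) with he
  have hp : ∀ (k : ℕ) (i l : Fin n), MvPolynomial.eval e ((Bp ^ k) i l) =
      ((Bp.map (MvPolynomial.eval e)) ^ k) i l := by
    intro k i l
    rw [← Matrix.map_pow, Matrix.map_apply]
  rw [last_row_formula hn (blockA X) (Bp.map (MvPolynomial.eval e)) ?_ ?_ ?_ ?_ j _ rfl]
  · simp only [map_add, map_neg, map_sum, map_mul, hp, MvPolynomial.eval_X]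
    rfl
  · intro i l hi
    simp [Bp, hi, he]
  · intro i l hi
    simp [Bp, hi]
  · intro i l h
    exact (hX i.castSucc l.castSucc).1 (by simpa using h)
  · intro i l h
    exact (hX i.castSucc l.castSucc).2 (by simpa using h)
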